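/- Assume the Continuum Hypothesis. Let K and L be nowhere dense closed P-sets in ω* and let h : K → L be a homeomorphism. Then there exists a homeomorphism H : ω* → ω* such that H(x) = h(x) for every x ∈ K. -/

import Mathlib

open Set Function

/-- A subset `P` of a topological space is a P-set if the intersection of every countable
family of neighborhoods of `P` is again a neighborhood of `P`. -/
def IsPSet {X : Type*} [TopologicalSpace X] (P : Set X) : Prop :=
  ∀ V : ℕ → Set X, (∀ n, P ⊆ interior (V n)) → P ⊆ interior (⋂ n, V n)

/-- The Čech–Stone remainder `ω* = βω \ ω` of the countable discrete space `ω`. -/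
def omegaStar : Set (StoneCech ℕ) := (Set.range (stoneCechUnit : ℕ → StoneCech ℕ))ᶜ

theorem IsPSet.subset_interior_of_isGδ {X : Type*} [TopologicalSpace X] {P G : Set X}
    (hP : IsPSet P) (hG : IsGδ G) (hPG : P ⊆ G) : P ⊆ interior G := by
  obtain ⟨O, hO, rfl⟩ := isGδ_iff_eq_iInter_nat.1 hG
  exact hP O fun n => by
    rw [(hO n).interior_eq]
    exact hPG.trans (iInter_subset _ n)

/-- The topological properties characterising `ω*` under the Continuum Hypothesis, apart from
its weight, stated for compact zero-dimensional Hausdorff spaces. -/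
structure IsParovicenko (X : Type*) [TopologicalSpace X] : Prop where
  exists_isClopen_separating : ∀ U V : ℕ → Set X, (∀ n, IsClopen (U n)) → (∀ n, IsClopen (V n)) →
    (∀ m n, Disjoint (U m) (V n)) →
    ∃ c, IsClopen c ∧ (∀ n, U n ⊆ c) ∧ ∀ n, Disjoint (V n) c
  interior_iInter_nonempty : ∀ C : ℕ → Set X, (∀ n, IsClopen (C n)) → (⋂ n, C n).Nonempty →
    (interior (⋂ n, C n)).Nonempty
  not_isOpen_singleton : ∀ x : X, ¬ IsOpen {x}

namespace IsParovicenko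

section Extension

variable {X : Type*} [TopologicalSpace X] [CompactSpace X] [T2Space X] [TotallyDisconnectedSpace X]

theorem interior_nonempty_of_isGδ (hX : IsParovicenko X) {G : Set X} (hG : IsGδ G)
    (hne : G.Nonempty) : (interior G).Nonempty := by
  obtain ⟨O, hO, rfl⟩ := isGδ_iff_eq_iInter_nat.1 hG
  obtain ⟨x, hx⟩ := hne
  choose C hC hxC hCO using fun n => compact_exists_isClopen_in_isOpen (hO n) (mem_iInter.1 hx n)
  exact (hX.interior_iInter_nonempty C hC ⟨x, mem_iInter.2 hxC⟩).mono
    (interior_mono (iInter_mono hCO))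

theorem exists_isClopen_subset_of_isGδ (hX : IsParovicenko X) {G L : Set X} (hG : IsGδ G)
    (hne : G.Nonempty) (hLc : IsClosed L) (hLn : IsNowhereDense L) :
    ∃ d, IsClopen d ∧ d.Nonempty ∧ d ⊆ G ∧ Disjoint d L := by
  have hd : Dense Lᶜ := interior_eq_empty_iff_dense_compl.1 (hLc.isNowhereDense_iff.1 hLn)
  obtain ⟨x, hx, hxL⟩ := hd.inter_open_nonempty _ isOpen_interior
    (hX.interior_nonempty_of_isGδ hG hne)
  obtain ⟨d, hdc, hxd, hdsub⟩ := compact_exists_isClopen_in_isOpen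
    (isOpen_interior.inter hLc.isOpen_compl) ⟨hx, hxL⟩
  exact ⟨d, hdc, ⟨x, hxd⟩, fun y hy => interior_subset (hdsub hy).1,
    disjoint_left.2 fun y hy => (hdsub hy).2⟩

theorem diff_nonempty_of_countable (hX : IsParovicenko X) {G C : Set X} (hG : IsGδ G)
    (hne : G.Nonempty) (hC : C.Countable) : (G \ C).Nonempty := by
  have hd : Dense (⋂ x ∈ C, ({x}ᶜ : Set X)) :=
    dense_biInter_of_isOpen (fun x _ => isOpen_compl_singleton) hC fun x _ =>
      dense_compl_singleton_iff_not_open.2 (hX.not_isOpen_singleton x)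
  obtain ⟨x, hx, hxC⟩ := hd.inter_open_nonempty _ isOpen_interior
    (hX.interior_nonempty_of_isGδ hG hne)
  exact ⟨x, interior_subset hx, fun hx' => mem_iInter₂.1 hxC x hx' rfl⟩

theorem exists_isClopen_separating_of_isGδ (hX : IsParovicenko X) {U V : Set X}
    (hU : IsOpen U) (hV : IsOpen V) (hUG : IsGδ Uᶜ) (hVG : IsGδ Vᶜ) (hUV : Disjoint U V) :
    ∃ c, IsClopen c ∧ U ⊆ c ∧ Disjoint V c := by
  have key : ∀ W : Set X, IsOpen W → IsGδ Wᶜ →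
      ∃ C : ℕ → Set X, (∀ n, IsClopen (C n)) ∧ W = ⋃ n, C n := by
    intro W hW hWG
    obtain ⟨O, hO, hWO⟩ := isGδ_iff_eq_iInter_nat.1 hWG
    have hsub : ∀ n, (O n)ᶜ ⊆ W := fun n =>
      compl_subset_comm.1 (hWO.subset.trans (iInter_subset _ n))
    choose C hC hOC hCW using fun n =>
      exists_clopen_of_closed_subset_open (hO n).isClosed_compl hW (hsub n)
    refine ⟨C, hC, subset_antisymm (fun x hx => ?_) (iUnion_subset hCW)⟩
    by_contra hx'
    have : x ∈ Wᶜ := by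
      rw [hWO]
      exact mem_iInter.2 fun n => by_contra fun h => hx' (mem_iUnion.2 ⟨n, hOC n h⟩)
    exact this hx
  obtain ⟨A, hA, rfl⟩ := key U hU hUG
  obtain ⟨B, hB, rfl⟩ := key V hV hVG
  obtain ⟨c, hc, hAc, hBc⟩ := hX.exists_isClopen_separating A B hA hB fun m n =>
    hUV.mono (subset_iUnion _ m) (subset_iUnion _ n)
  exact ⟨c, hc, iUnion_subset hAc, disjoint_iUnion_left.2 hBc⟩

/-- Separation of two open `Fσ` sets by a clopen set with prescribed trace on a P-set. -/
theorem exists_isClopen_separating_of_isPSet (hX : IsParovicenko X) {U V D E : Set X}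
    (hU : IsOpen U) (hV : IsOpen V) (hUG : IsGδ Uᶜ) (hVG : IsGδ Vᶜ) (hUV : Disjoint U V)
    (hD : IsClosed D) (hE : IsClosed E) (hDE : Disjoint D E) (hP : IsPSet (D ∪ E))
    (hDV : Disjoint D V) (hEU : Disjoint E U) :
    ∃ c, IsClopen c ∧ U ⊆ c ∧ Disjoint V c ∧ D ⊆ c ∧ Disjoint E c := by
  obtain ⟨w, hw, hDw, hwE⟩ := exists_clopen_of_closed_subset_open hD hE.isOpen_compl
    (subset_compl_iff_disjoint_right.2 hDE)
  have hG : IsGδ ((Vᶜ ∪ wᶜ) ∩ (Uᶜ ∪ w)) :=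
    (hVG.union hw.compl.isOpen.isGδ).inter (hUG.union hw.isOpen.isGδ)
  have hsub : D ∪ E ⊆ (Vᶜ ∪ wᶜ) ∩ (Uᶜ ∪ w) := by
    rintro x (hx | hx)
    · exact ⟨Or.inl (disjoint_left.1 hDV hx), Or.inr (hDw hx)⟩
    · exact ⟨Or.inr fun h => hwE h hx, Or.inl (disjoint_left.1 hEU hx)⟩
  obtain ⟨q, hq, hqL, hqG⟩ := exists_clopen_of_closed_subset_open (hD.union hE) isOpen_interior
    (hP.subset_interior_of_isGδ hG hsub)
  obtain ⟨c, hc, hUc, hVc⟩ := hX.exists_isClopen_separating_of_isGδ hU hV hUG hVG hUV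
  refine ⟨(c \ q) ∪ (q ∩ w), (hc.diff hq).union (hq.inter hw), fun x hx => ?_,
    disjoint_left.2 fun x hx => ?_, fun x hx => Or.inr ⟨hqL (Or.inl hx), hDw hx⟩,
    disjoint_left.2 fun x hx => ?_⟩
  · by_cases hxq : x ∈ q
    · exact Or.inr ⟨hxq, (interior_subset (hqG hxq)).2.resolve_left (not_not_intro hx)⟩
    · exact Or.inl ⟨hUc hx, hxq⟩
  · rintro (h | h)
    · exact disjoint_left.1 hVc hx h.1
    · exact (interior_subset (hqG h.1)).1.elim (fun h' => h' hx) fun h' => h' h.2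
  · rintro (h | h)
    · exact h.2 (hqL (Or.inr hx))
    · exact hwE h.2 hx

/-- If `τ` and `τ'` have the same range in a second countable space, then every clopen set `b`
can be matched by a clopen set `c` with the same image and a prescribed trace on a nowhere
dense P-set. -/
theorem exists_isClopen_image_eq (hX : IsParovicenko X) {Y : Type*} [TopologicalSpace Y]
    [TopologicalSpace.MetrizableSpace Y] [SecondCountableTopology Y]
    {τ τ' : X → Y} (hτ : Continuous τ) (hτ' : Continuous τ') (hr : range τ = range τ')
    {b D E : Set X} (hb : IsClopen b) (hD : IsClosed D) (hE : IsClosed E) (hDE : Disjoint D E)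
    (hP : IsPSet (D ∪ E)) (hN : IsNowhereDense (D ∪ E))
    (hDb : MapsTo τ' D (τ '' b)) (hEb : MapsTo τ' E (τ '' bᶜ)) :
    ∃ c, IsClopen c ∧ D ⊆ c ∧ Disjoint E c ∧ τ' '' c = τ '' b ∧ τ' '' cᶜ = τ '' bᶜ := by
  have hZ : IsClosed (τ '' b) := (hb.isClosed.isCompact.image hτ).isClosed
  have hW : IsClosed (τ '' bᶜ) := (hb.compl.isClosed.isCompact.image hτ).isClosed
  obtain ⟨A, hAZ, hAc, hZA⟩ :=
    (TopologicalSpace.IsSeparable.of_separableSpace (τ '' b)).exists_countable_dense_subset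
  obtain ⟨B, hBW, hBc, hWB⟩ :=
    (TopologicalSpace.IsSeparable.of_separableSpace (τ '' bᶜ)).exists_countable_dense_subset
  have hlift : ∀ x, ∃ y, τ' y = τ x := fun x => hr.subset ⟨x, rfl⟩
  have hBr : ∀ w ∈ B, ∃ y, τ' y = w := fun w hw => by
    obtain ⟨x, -, rfl⟩ := hBW hw
    exact hlift x
  have hAr : ∀ z ∈ A, ∃ y, τ' y = z := fun z hz => by
    obtain ⟨x, -, rfl⟩ := hAZ hz
    exact hlift x
  have hfib : ∀ z, IsGδ (τ' ⁻¹' {z}) := fun z => isClosed_singleton.isGδ.preimage hτ'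
  have : Countable A := hAc.to_subtype
  have : Countable B := hBc.to_subtype
  choose y hy using fun w : B => hBr w w.2
  have hLc := hD.union hE
  choose d hdc hdne hdsub hdL using fun z : A =>
    hX.exists_isClopen_subset_of_isGδ ((hfib z).inter (countable_range y).isGδ_compl)
      (hX.diff_nonempty_of_countable (hfib z) (hAr z z.2) (countable_range y)) hLc hN
  choose e hec hene hesub heL using fun w : B =>
    hX.exists_isClopen_subset_of_isGδ (G := τ' ⁻¹' {(w : Y)} ∩ ⋂ z, (d z)ᶜ)
      ((hfib w).inter (IsGδ.iInter_of_isOpen fun z => (hdc z).compl.isOpen))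
      ⟨y w, hy w, mem_iInter.2 fun z hz => (hdsub z hz).2 ⟨w, rfl⟩⟩ hLc hN
  have hcover : ∀ x, τ' x ∈ τ '' b ∨ τ' x ∈ τ '' bᶜ := by
    intro x
    obtain ⟨x', hx'⟩ := hr.symm.subset ⟨x, rfl⟩
    by_cases h : x' ∈ b
    · exact Or.inl ⟨x', h, hx'⟩
    · exact Or.inr ⟨x', h, hx'⟩
  have hdZ : ∀ z, ∀ x ∈ d z, τ' x ∈ τ '' b := fun z x hx => by
    rw [show τ' x = z from (hdsub z hx).1]
    exact hAZ z.2
  have heW : ∀ w, ∀ x ∈ e w, τ' x ∈ τ '' bᶜ := fun w x hx => by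
    rw [show τ' x = w from (hesub w hx).1]
    exact hBW w.2
  obtain ⟨c, hc, hUc, hVc, hDc, hEc⟩ := hX.exists_isClopen_separating_of_isPSet
    (U := τ' ⁻¹' (τ '' bᶜ)ᶜ ∪ ⋃ z, d z) (V := τ' ⁻¹' (τ '' b)ᶜ ∪ ⋃ w, e w)
    ((hW.isOpen_compl.preimage hτ').union (isOpen_iUnion fun z => (hdc z).isOpen))
    ((hZ.isOpen_compl.preimage hτ').union (isOpen_iUnion fun z => (hec z).isOpen))
    (by
      rw [compl_union, compl_iUnion, ← preimage_compl, compl_compl]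
      exact (hW.isGδ.preimage hτ').inter
        (IsGδ.iInter_of_isOpen fun z => (hdc z).compl.isOpen))
    (by
      rw [compl_union, compl_iUnion, ← preimage_compl, compl_compl]
      exact (hZ.isGδ.preimage hτ').inter
        (IsGδ.iInter_of_isOpen fun z => (hec z).compl.isOpen))
    (by
      refine disjoint_left.2 ?_
      rintro x (hx | hx) (hx' | hx')
      · exact (hcover x).elim hx' hx
      · obtain ⟨w, hw⟩ := mem_iUnion.1 hx'
        exact hx (heW w x hw)
      · obtain ⟨z, hz⟩ := mem_iUnion.1 hx
        exact hx' (hdZ z x hz)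
      · obtain ⟨z, hz⟩ := mem_iUnion.1 hx
        obtain ⟨w, hw⟩ := mem_iUnion.1 hx'
        exact mem_iInter.1 (hesub w hw).2 z hz)
    hD hE hDE hP
    (disjoint_union_right.2 ⟨disjoint_left.2 fun x hx hx' => hx' (hDb hx),
      disjoint_iUnion_right.2 fun w => ((heL w).mono_right subset_union_left).symm⟩)
    (disjoint_union_right.2 ⟨disjoint_left.2 fun x hx hx' => hx' (hEb hx),
      disjoint_iUnion_right.2 fun z => ((hdL z).mono_right subset_union_right).symm⟩)
  refine ⟨c, hc, hDc, hEc, subset_antisymm ?_ ?_, subset_antisymm ?_ ?_⟩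
  · rintro _ ⟨x, hx, rfl⟩
    by_contra h
    exact disjoint_left.1 hVc (Or.inl h) hx
  · refine hZA.trans (closure_minimal (fun z hz => ?_)
      (hc.isClosed.isCompact.image hτ').isClosed)
    obtain ⟨x, hx⟩ := hdne ⟨z, hz⟩
    exact ⟨x, hUc (Or.inr (mem_iUnion.2 ⟨_, hx⟩)), (hdsub _ hx).1⟩
  · rintro _ ⟨x, hx, rfl⟩
    by_contra h
    exact hx (hUc (Or.inl h))
  · refine hWB.trans (closure_minimal (fun w hw => ?_)
      (hc.compl.isClosed.isCompact.image hτ').isClosed)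
    obtain ⟨x, hx⟩ := hene ⟨w, hw⟩
    exact ⟨x, disjoint_left.1 hVc (Or.inr (mem_iUnion.2 ⟨_, hx⟩)), (hesub _ hx).1⟩

end Extension

section BackAndForth

variable {X : Type*} [TopologicalSpace X] {K L : Set X}

/-- A family `R` of pairs of clopen sets is compatible with `h : K → L` if it generates a
partial isomorphism of the algebra of clopen sets that respects `h`. -/
structure Compatible (h : K ≃ₜ L) (R : Set (Set X × Set X)) : Prop where
  isClopen_fst : ∀ r ∈ R, IsClopen r.1
  isClopen_snd : ∀ r ∈ R, IsClopen r.2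
  exists_right : ∀ x, ∃ y, ∀ r ∈ R, x ∈ r.1 ↔ y ∈ r.2
  exists_left : ∀ y, ∃ x, ∀ r ∈ R, x ∈ r.1 ↔ y ∈ r.2
  apply_mem_iff : ∀ r ∈ R, ∀ x : K, (x : X) ∈ r.1 ↔ (h x : X) ∈ r.2

namespace Compatible

variable {h : K ≃ₜ L} {R : Set (Set X × Set X)}

theorem image_swap (hR : Compatible h R) : Compatible h.symm (Prod.swap '' R) where
  isClopen_fst := forall_mem_image.2 hR.isClopen_snd
  isClopen_snd := forall_mem_image.2 hR.isClopen_fst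
  exists_right y := by
    obtain ⟨x, hx⟩ := hR.exists_left y
    exact ⟨x, forall_mem_image.2 fun r hr => (hx r hr).symm⟩
  exists_left x := by
    obtain ⟨y, hy⟩ := hR.exists_right x
    exact ⟨y, forall_mem_image.2 fun r hr => (hy r hr).symm⟩
  apply_mem_iff := forall_mem_image.2 fun r hr y => by
    simpa using (hR.apply_mem_iff r hr (h.symm y)).symm

theorem empty (h : K ≃ₜ L) : Compatible h ∅ where
  isClopen_fst _ hr := hr.elim
  isClopen_snd _ hr := hr.elim
  exists_right x := ⟨x, fun _ hr => hr.elim⟩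
  exists_left x := ⟨x, fun _ hr => hr.elim⟩
  apply_mem_iff _ hr := hr.elim

theorem exists_right_iUnion [CompactSpace X] {ι : Type*} [Nonempty ι]
    {S : ι → Set (Set X × Set X)} (hS : Directed (· ⊆ ·) S) (hc : ∀ i, Compatible h (S i))
    (x : X) : ∃ y, ∀ r ∈ ⋃ i, S i, x ∈ r.1 ↔ y ∈ r.2 := by
  have hcl : ∀ i, IsClosed {y | ∀ r ∈ S i, x ∈ r.1 ↔ y ∈ r.2} := fun i => by
    simp only [ofPred_forall]
    refine isClosed_biInter fun r hr => ?_
    by_cases hx : x ∈ r.1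
    · simpa [hx] using ((hc i).isClopen_snd r hr).isClosed
    · simp only [hx, false_iff]
      exact ((hc i).isClopen_snd r hr).compl.isClosed
  obtain ⟨y, hy⟩ := IsCompact.nonempty_iInter_of_directed_nonempty_isCompact_isClosed
    (fun i => {y | ∀ r ∈ S i, x ∈ r.1 ↔ y ∈ r.2})
    (fun i j => by
      obtain ⟨k, hik, hjk⟩ := hS i j
      exact ⟨k, fun y hy r hr => hy r (hik hr), fun y hy r hr => hy r (hjk hr)⟩)
    (fun i => (hc i).exists_right x) (fun i => (hcl i).isCompact) hcl
  refine ⟨y, fun r hr => ?_⟩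
  obtain ⟨i, hi⟩ := mem_iUnion.1 hr
  exact mem_iInter.1 hy i r hi

theorem iUnion [CompactSpace X] {ι : Type*} {S : ι → Set (Set X × Set X)}
    (hS : Directed (· ⊆ ·) S) (hc : ∀ i, Compatible h (S i)) : Compatible h (⋃ i, S i) := by
  rcases isEmpty_or_nonempty ι with _ | _
  · rw [iUnion_of_empty]
    exact empty h
  refine ⟨fun r hr => ?_, fun r hr => ?_, exists_right_iUnion hS hc, fun y => ?_, fun r hr => ?_⟩
  · obtain ⟨i, hi⟩ := mem_iUnion.1 hr
    exact (hc i).isClopen_fst r hi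
  · obtain ⟨i, hi⟩ := mem_iUnion.1 hr
    exact (hc i).isClopen_snd r hi
  · obtain ⟨x, hx⟩ := exists_right_iUnion (S := fun i => Prod.swap '' S i)
      (fun i j => (hS i j).imp fun k hk => ⟨image_mono hk.1, image_mono hk.2⟩)
      (fun i => (hc i).image_swap) y
    refine ⟨x, fun r hr => (hx r.swap ?_).symm⟩
    rw [← image_iUnion]
    exact mem_image_of_mem _ hr
  · obtain ⟨i, hi⟩ := mem_iUnion.1 hr
    exact (hc i).apply_mem_iff r hi

variable [CompactSpace X] [T2Space X] [TotallyDisconnectedSpace X]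

theorem exists_insert_fst (hX : IsParovicenko X) (hLc : IsClosed L) (hLn : IsNowhereDense L)
    (hLp : IsPSet L) (hR : Compatible h R) (hRc : R.Countable) {b : Set X} (hb : IsClopen b) :
    ∃ c, Compatible h (insert (b, c) R) := by
  have : Countable R := hRc.to_subtype
  let τ : X → R → Bool := fun x r => r.1.1.boolIndicator x
  let τ' : X → R → Bool := fun y r => r.1.2.boolIndicator y
  have hτ : Continuous τ := continuous_pi fun r =>
    (continuous_boolIndicator_iff_isClopen _).2 (hR.isClopen_fst r r.2)
  have hτ' : Continuous τ' := continuous_pi fun r =>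
    (continuous_boolIndicator_iff_isClopen _).2 (hR.isClopen_snd r r.2)
  have hττ' : ∀ {x y}, τ' y = τ x ↔ ∀ r ∈ R, x ∈ r.1 ↔ y ∈ r.2 := by
    intro x y
    simp only [funext_iff, Subtype.forall, τ, τ']
    refine forall₂_congr fun r hr => ?_
    rw [mem_iff_boolIndicator, mem_iff_boolIndicator, Bool.coe_iff_coe, eq_comm]
  have hr : range τ = range τ' := by
    refine subset_antisymm ?_ ?_ <;> rintro _ ⟨x, rfl⟩
    · exact (hR.exists_right x).imp fun y hy => hττ'.2 hy
    · exact (hR.exists_left x).imp fun y hy => (hττ'.2 hy).symm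
  have htrace : ∀ s : Set X, IsClopen s →
      IsClosed (Subtype.val '' (h.symm ⁻¹' (Subtype.val ⁻¹' s)) : Set X) := fun s hs =>
    hLc.isClosedEmbedding_subtypeVal.isClosedMap _
      ((hs.isClosed.preimage continuous_subtype_val).preimage h.symm.continuous)
  have hmaps : ∀ s : Set X,
      MapsTo τ' (Subtype.val '' (h.symm ⁻¹' (Subtype.val ⁻¹' s)) : Set X) (τ '' s) := by
    rintro s _ ⟨y, hy, rfl⟩
    refine ⟨h.symm y, hy, (hττ'.2 fun r hr => ?_).symm⟩
    simpa using hR.apply_mem_iff r hr (h.symm y)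
  have hunion : (Subtype.val '' (h.symm ⁻¹' (Subtype.val ⁻¹' b)) ∪
      Subtype.val '' (h.symm ⁻¹' (Subtype.val ⁻¹' bᶜ)) : Set X) = L := by
    rw [← image_union, preimage_compl, preimage_compl, union_compl_self, image_univ,
      Subtype.range_coe]
  obtain ⟨c, hc, hDc, hEc, hb', hbc'⟩ := hX.exists_isClopen_image_eq hτ hτ' hr hb (htrace b hb)
    (htrace bᶜ hb.compl)
    ((disjoint_image_iff Subtype.val_injective).2 disjoint_compl_right)
    (hunion.symm ▸ hLp) (hunion.symm ▸ hLn) (hmaps b) (hmaps bᶜ)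
  refine ⟨c, ⟨?_, ?_, fun x => ?_, fun y => ?_, ?_⟩⟩
  · exact forall_mem_insert.2 ⟨hb, hR.isClopen_fst⟩
  · exact forall_mem_insert.2 ⟨hc, hR.isClopen_snd⟩
  · by_cases hx : x ∈ b
    · obtain ⟨y, hy, hyx⟩ := hb'.superset ⟨x, hx, rfl⟩
      exact ⟨y, forall_mem_insert.2 ⟨iff_of_true hx hy, hττ'.1 hyx⟩⟩
    · obtain ⟨y, hy, hyx⟩ := hbc'.superset ⟨x, hx, rfl⟩
      exact ⟨y, forall_mem_insert.2 ⟨iff_of_false hx hy, hττ'.1 hyx⟩⟩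
  · by_cases hy : y ∈ c
    · obtain ⟨x, hx, hyx⟩ := hb'.subset ⟨y, hy, rfl⟩
      exact ⟨x, forall_mem_insert.2 ⟨iff_of_true hx hy, hττ'.1 hyx.symm⟩⟩
    · obtain ⟨x, hx, hyx⟩ := hbc'.subset ⟨y, hy, rfl⟩
      exact ⟨x, forall_mem_insert.2 ⟨iff_of_false hx hy, hττ'.1 hyx.symm⟩⟩
  · refine forall_mem_insert.2 ⟨fun x => ?_, hR.apply_mem_iff⟩
    by_cases hx : (x : X) ∈ b
    · exact iff_of_true hx (hDc ⟨h x, by simpa using hx, rfl⟩)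
    · exact iff_of_false hx (disjoint_left.1 hEc ⟨h x, by simpa using hx, rfl⟩)

theorem exists_insert_snd (hX : IsParovicenko X) (hKc : IsClosed K) (hKn : IsNowhereDense K)
    (hKp : IsPSet K) (hR : Compatible h R) (hRc : R.Countable) {c : Set X} (hc : IsClopen c) :
    ∃ b, Compatible h (insert (b, c) R) := by
  obtain ⟨b, hb⟩ := hR.image_swap.exists_insert_fst hX hKc hKn hKp (hRc.image _) hc
  have hb' := hb.image_swap
  rw [image_insert_eq, image_image] at hb'
  simp only [Prod.swap_swap, image_id'] at hb'
  exact ⟨b, hb'⟩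

/-- A compatible family in which every clopen set occurs on both sides induces a
homeomorphism extending `h`. -/
theorem exists_homeomorph (hR : Compatible h R) (hfst : ∀ b, IsClopen b → ∃ c, (b, c) ∈ R)
    (hsnd : ∀ c, IsClopen c → ∃ b, (b, c) ∈ R) :
    ∃ H : X ≃ₜ X, ∀ x : K, H x = h x := by
  choose f hf using hR.exists_right
  have huniq : ∀ x y, (∀ r ∈ R, x ∈ r.1 ↔ y ∈ r.2) → f x = y := by
    intro x y hy
    by_contra hne
    obtain ⟨c, hc, hfc, hyc⟩ := exists_isClopen_of_totally_separated hne
    obtain ⟨b, hbc⟩ := hsnd c hc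
    exact hyc ((hy _ hbc).1 ((hf x _ hbc).2 hfc))
  have hinj : Injective f := by
    intro x x' hxx'
    by_contra hne
    obtain ⟨b, hb, hxb, hxb'⟩ := exists_isClopen_of_totally_separated hne
    obtain ⟨c, hbc⟩ := hfst b hb
    exact hxb' ((hf x' _ hbc).2 (hxx' ▸ (hf x _ hbc).1 hxb))
  have hsurj : Surjective f := fun y => by
    obtain ⟨x, hx⟩ := hR.exists_left y
    exact ⟨x, huniq x y hx⟩
  have hcont : Continuous f := by
    refine isTopologicalBasis_isClopen.continuous_iff.2 fun c hc => ?_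
    obtain ⟨b, hbc⟩ := hsnd c hc
    convert (hR.isClopen_fst _ hbc).isOpen using 1
    ext x
    exact (hf x _ hbc).symm
  refine ⟨hcont.homeoOfEquivCompactToT2 (f := Equiv.ofBijective f ⟨hinj, hsurj⟩), fun x => ?_⟩
  exact huniq x (h x) fun r hr => hR.apply_mem_iff r hr x

end Compatible

/-- The back-and-forth construction of length `ω₁`. -/
theorem exists_homeomorph_extending {X : Type*} [TopologicalSpace X] [CompactSpace X] [T2Space X]
    [TotallyDisconnectedSpace X] (hX : IsParovicenko X)
    (hw : Cardinal.mk {c : Set X // IsClopen c} ≤ Cardinal.aleph 1) {K L : Set X}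
    (hKc : IsClosed K) (hKn : IsNowhereDense K) (hKp : IsPSet K)
    (hLc : IsClosed L) (hLn : IsNowhereDense L) (hLp : IsPSet L) (h : K ≃ₜ L) :
    ∃ H : X ≃ₜ X, ∀ x : K, H x = h x := by
  let T := (Cardinal.aleph 1).ord.ToType
  have hT : Cardinal.mk T = Cardinal.aleph 1 := Cardinal.mk_ord_toType _
  let Task := {c : Set X // IsClopen c} ⊕ {c : Set X // IsClopen c}
  have hTask : Cardinal.mk Task ≤ Cardinal.mk T := by
    rw [hT, Cardinal.mk_sum, Cardinal.lift_id]
    exact Cardinal.add_le_of_le (Cardinal.aleph0_le_aleph 1) hw hw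
  have : Nonempty Task := ⟨Sum.inl ⟨∅, isClopen_empty⟩⟩
  obtain ⟨⟨g, hg⟩⟩ := hTask
  let task : T → Task := invFun g
  have htask : Surjective task := invFun_surjective hg
  let Solves : Set X × Set X → Task → Prop := fun p =>
    Sum.elim (fun b => p.1 = b) (fun c => p.2 = c)
  have hstep : ∀ (R : Set (Set X × Set X)) (t : Task), ∃ p, Compatible h R → R.Countable →
      Compatible h (insert p R) ∧ Solves p t := by
    intro R t
    by_cases hR : Compatible h R ∧ R.Countable
    · obtain ⟨hR, hRc⟩ := hR
      rcases t with b | c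
      · obtain ⟨c, hc⟩ := hR.exists_insert_fst hX hLc hLn hLp hRc b.2
        exact ⟨(b, c), fun _ _ => ⟨hc, rfl⟩⟩
      · obtain ⟨b, hb⟩ := hR.exists_insert_snd hX hKc hKn hKp hRc c.2
        exact ⟨(b, c), fun _ _ => ⟨hb, rfl⟩⟩
    · exact ⟨(∅, ∅), fun h₁ h₂ => (hR ⟨h₁, h₂⟩).elim⟩
  choose next hnext using hstep
  have hwf : WellFounded ((· < ·) : T → T → Prop) := wellFounded_lt
  let p : T → Set X × Set X := hwf.fix fun t ih =>
    next {r | ∃ (s : T) (hs : s < t), ih s hs = r} (task t)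
  have hp : ∀ t, p t = next (p '' Iio t) (task t) := by
    intro t
    change hwf.fix _ t = _
    rw [hwf.fix_eq]
    congr 1
    ext r
    simp [p]
  have hcount : ∀ t : T, (p '' Iio t).Countable := fun t =>
    Countable.image (Cardinal.le_aleph0_iff_set_countable.1 (Cardinal.lt_aleph_one_iff.1
      ((Cardinal.mk_Iio_lt t (by rw [hT, Ordinal.type_toType])).trans_eq hT))) p
  have hIic : ∀ t, Compatible h (p '' Iio t) →
      Compatible h (p '' Iic t) ∧ Solves (p t) (task t) := by
    intro t ht
    have := hnext _ (task t) ht (hcount t)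
    rwa [← hp, ← image_insert_eq, Iio_insert] at this
  have hIio : ∀ t, Compatible h (p '' Iio t) := by
    intro t
    induction t using hwf.induction with
    | _ t ih =>
      have : p '' Iio t = ⋃ s : Iio t, p '' Iic (s : T) := by
        rw [← image_iUnion]
        congr 1
        ext r
        simp only [mem_Iio, mem_iUnion, mem_Iic, Subtype.exists, exists_prop]
        exact ⟨fun hr => ⟨r, hr, le_rfl⟩, fun ⟨s, hs, hrs⟩ => hrs.trans_lt hs⟩
      rw [this]
      refine Compatible.iUnion ?_ fun s => (hIic s (ih s s.2)).1
      exact Monotone.directed_le fun s s' hss' => image_mono (Iic_subset_Iic.2 hss')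
  have hall : Compatible h (⋃ t, p '' Iic t) :=
    Compatible.iUnion (Monotone.directed_le fun s s' hss' => image_mono (Iic_subset_Iic.2 hss'))
      fun t => (hIic t (hIio t)).1
  have hmem : ∀ t, p t ∈ ⋃ t, p '' Iic t := fun t =>
    mem_iUnion.2 ⟨t, mem_image_of_mem p (mem_Iic.2 le_rfl)⟩
  refine hall.exists_homeomorph (fun b hb => ?_) fun c hc => ?_
  · obtain ⟨t, ht⟩ := htask (Sum.inl ⟨b, hb⟩)
    have hs : (p t).1 = b := by simpa [Solves, ht] using (hIic t (hIio t)).2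
    subst hs
    exact ⟨(p t).2, hmem t⟩
  · obtain ⟨t, ht⟩ := htask (Sum.inr ⟨c, hc⟩)
    have hs : (p t).2 = c := by simpa [Solves, ht] using (hIic t (hIio t)).2
    subst hs
    exact ⟨(p t).1, hmem t⟩

end BackAndForth

end IsParovicenko

section Remainder

/-- The clopen subset of `ω*` determined by a subset of `ω`. -/
noncomputable def omegaStar.trace (A : Set ℕ) : Set omegaStar :=
  {x | stoneCechExtend (continuous_of_discreteTopology (f := A.boolIndicator)) x.1 = true}

theorem stoneCechExtend_boolIndicator_unit (A : Set ℕ) (n : ℕ) :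
    stoneCechExtend (continuous_of_discreteTopology (f := A.boolIndicator)) (stoneCechUnit n) =
      true ↔ n ∈ A := by
  rw [stoneCechExtend_stoneCechUnit, mem_iff_boolIndicator]

theorem isClopen_stoneCechExtend_boolIndicator (A : Set ℕ) :
    IsClopen {x | stoneCechExtend (continuous_of_discreteTopology (f := A.boolIndicator)) x =
      true} :=
  (isClopen_discrete {true}).preimage (continuous_stoneCechExtend _)

theorem stoneCech_isClopen_eq {C D : Set (StoneCech ℕ)} (hC : IsClopen C) (hD : IsClopen D)
    (h : ∀ n, stoneCechUnit n ∈ C ↔ stoneCechUnit n ∈ D) : C = D := by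
  have hsub : ∀ {C D : Set (StoneCech ℕ)}, IsClopen C → IsClopen D →
      (∀ n, stoneCechUnit n ∈ C → stoneCechUnit n ∈ D) → C ⊆ D := by
    intro C D hC hD h x hx
    by_contra hxD
    obtain ⟨n, hn, hnD⟩ := denseRange_stoneCechUnit.exists_mem_open
      (hC.isOpen.inter hD.compl.isOpen) ⟨x, hx, hxD⟩
    exact hnD (h n hn)
  exact subset_antisymm (hsub hC hD fun n => (h n).1) (hsub hD hC fun n => (h n).2)

theorem isOpen_singleton_stoneCechUnit (n : ℕ) :
    IsOpen {(stoneCechUnit n : StoneCech ℕ)} := by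
  convert (isClopen_stoneCechExtend_boolIndicator {n}).isOpen using 1
  refine subset_antisymm (singleton_subset_iff.2
    ((stoneCechExtend_boolIndicator_unit _ _).2 rfl)) fun x hx => ?_
  by_contra hne
  obtain ⟨m, hm, hmn⟩ := denseRange_stoneCechUnit.exists_mem_open
    ((isClopen_stoneCechExtend_boolIndicator {n}).isOpen.inter isOpen_compl_singleton) ⟨x, hx, hne⟩
  have hmn' : m = n := (stoneCechExtend_boolIndicator_unit {n} m).1 hm
  exact hmn (congrArg _ hmn')

namespace omegaStar

theorem isClosed : IsClosed omegaStar := by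
  rw [omegaStar, ← iUnion_singleton_eq_range]
  exact (isOpen_iUnion isOpen_singleton_stoneCechUnit).isClosed_compl

instance : CompactSpace omegaStar := isCompact_iff_compactSpace.1 isClosed.isCompact

instance : TotallySeparatedSpace (StoneCech ℕ) :=
  have : ExtremallyDisconnected (StoneCech ℕ) := StoneCech.projective.extremallyDisconnected
  inferInstance

theorem isClopen_trace (A : Set ℕ) : IsClopen (trace A) :=
  (isClopen_stoneCechExtend_boolIndicator A).preimage continuous_subtype_val

theorem exists_trace_eq {C : Set omegaStar} (hC : IsClopen C) : ∃ A, trace A = C := by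
  have hcl : ∀ {C : Set omegaStar}, IsClosed C → IsClosed (Subtype.val '' C) := fun h =>
    isClosed.isClosedEmbedding_subtypeVal.isClosedMap _ h
  obtain ⟨E, hE, hCE, hEC⟩ := exists_clopen_of_closed_subset_open (hcl hC.isClosed)
    (hcl hC.compl.isClosed).isOpen_compl (subset_compl_iff_disjoint_right.2
      ((disjoint_image_iff Subtype.val_injective).2 disjoint_compl_right))
  refine ⟨stoneCechUnit ⁻¹' E, ?_⟩
  have : {x | stoneCechExtend (continuous_of_discreteTopology
      (f := (stoneCechUnit ⁻¹' E : Set ℕ).boolIndicator)) x = true} = E :=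
    stoneCech_isClopen_eq (isClopen_stoneCechExtend_boolIndicator _) hE fun n =>
      stoneCechExtend_boolIndicator_unit _ n
  ext x
  refine (Set.ext_iff.1 this x).trans
    ⟨fun hx => by_contra fun hxC => hEC hx ⟨x, hxC, rfl⟩, fun hx => hCE ⟨x, hx, rfl⟩⟩

theorem trace_inter (A B : Set ℕ) : trace (A ∩ B) = trace A ∩ trace B := by
  have := stoneCech_isClopen_eq (isClopen_stoneCechExtend_boolIndicator (A ∩ B))
    ((isClopen_stoneCechExtend_boolIndicator A).inter (isClopen_stoneCechExtend_boolIndicator B))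
    fun n => by simp only [mem_inter_iff, mem_ofPred_eq, stoneCechExtend_boolIndicator_unit]
  ext x
  exact Set.ext_iff.1 this x

theorem trace_compl (A : Set ℕ) : trace Aᶜ = (trace A)ᶜ := by
  have := stoneCech_isClopen_eq (isClopen_stoneCechExtend_boolIndicator Aᶜ)
    (isClopen_stoneCechExtend_boolIndicator A).compl
    fun n => by simp only [mem_compl_iff, mem_ofPred_eq, stoneCechExtend_boolIndicator_unit]
  ext x
  exact Set.ext_iff.1 this x

theorem trace_eq_empty_iff {A : Set ℕ} : trace A = ∅ ↔ A.Finite := by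
  have hA := isClopen_stoneCechExtend_boolIndicator A
  constructor
  · intro h
    obtain ⟨t, ht⟩ := hA.isClosed.isCompact.elim_finite_subcover
      (fun n : ℕ => {(stoneCechUnit n : StoneCech ℕ)}) isOpen_singleton_stoneCechUnit fun x hx => by
        rw [iUnion_singleton_eq_range]
        by_contra hx'
        exact notMem_empty (⟨x, hx'⟩ : omegaStar) (h ▸ hx)
    refine t.finite_toSet.subset fun n hn => ?_
    obtain ⟨m, hm, hmn⟩ := mem_iUnion₂.1 (ht ((stoneCechExtend_boolIndicator_unit A n).2 hn))
    have hmn' : n = m := by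
      have := (stoneCechExtend_boolIndicator_unit {m} n).1 (by
        rw [show (stoneCechUnit n : StoneCech ℕ) = stoneCechUnit m from hmn]
        exact (stoneCechExtend_boolIndicator_unit {m} m).2 rfl)
      exact this
    exact hmn' ▸ hm
  · intro h
    have hfin : IsClosed (stoneCechUnit '' A : Set (StoneCech ℕ)) := (h.image _).isClosed
    refine eq_empty_iff_forall_notMem.2 fun x hx => ?_
    obtain ⟨n, hn, hnA⟩ := denseRange_stoneCechUnit.exists_mem_open
      (hA.isOpen.inter hfin.isOpen_compl) ⟨x.1, hx, fun ⟨n, _, hn⟩ => x.2 ⟨n, hn⟩⟩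
    exact hnA ⟨n, (stoneCechExtend_boolIndicator_unit A n).1 hn, rfl⟩

theorem disjoint_trace_iff {A B : Set ℕ} : Disjoint (trace A) (trace B) ↔ (A ∩ B).Finite := by
  rw [disjoint_iff_inter_eq_empty, ← trace_inter, trace_eq_empty_iff]

theorem trace_subset_iff {A B : Set ℕ} : trace A ⊆ trace B ↔ (A \ B).Finite := by
  rw [← disjoint_compl_right_iff_subset, ← trace_compl, disjoint_trace_iff, sdiff_eq]

theorem isParovicenko : IsParovicenko omegaStar where
  exists_isClopen_separating U V hU hV hUV := by
    choose A hA using fun n => exists_trace_eq (hU n)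
    choose B hB using fun n => exists_trace_eq (hV n)
    have hAB : ∀ m n, (A m ∩ B n).Finite := fun m n => by
      rw [← disjoint_trace_iff, hA, hB]
      exact hUV m n
    refine ⟨trace (⋃ n, A n \ ⋃ m ∈ Iic n, B m), isClopen_trace _, fun n => ?_, fun m => ?_⟩
    · rw [← hA, trace_subset_iff]
      refine ((finite_Iic n).biUnion fun m _ => hAB n m).subset ?_
      rintro x ⟨hx, hx'⟩
      by_contra hne
      refine hx' (mem_iUnion.2 ⟨n, hx, fun h => hne ?_⟩)
      obtain ⟨m, hm, hxm⟩ := mem_iUnion₂.1 h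
      exact mem_iUnion₂.2 ⟨m, hm, hx, hxm⟩
    · rw [← hB, disjoint_trace_iff]
      refine ((finite_Iio m).biUnion fun n _ => hAB n m).subset ?_
      rintro x ⟨hx, hx'⟩
      obtain ⟨n, hxn, hxn'⟩ := mem_iUnion.1 hx'
      refine mem_iUnion₂.2 ⟨n, mem_Iio.2 (not_le.1 fun hmn => hxn' ?_), hxn, hx⟩
      exact mem_iUnion₂.2 ⟨m, hmn, hx⟩
  interior_iInter_nonempty C hC hne := by
    choose A hA using fun n => exists_trace_eq (hC n)
    obtain ⟨x, hx⟩ := hne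
    have hxA : ∀ n, x ∈ trace (A n) := fun n => hA n ▸ mem_iInter.1 hx n
    have hmem : ∀ n, x ∈ trace (⋂ m ≤ n, A m) := fun n => by
      induction n with
      | zero => simpa using hxA 0
      | succ n ih =>
        rw [biInter_le_succ, trace_inter]
        exact ⟨ih, hxA (n + 1)⟩
    have hinf : ∀ n, (⋂ m ≤ n, A m).Infinite := fun n hn =>
      notMem_empty x (trace_eq_empty_iff.2 hn ▸ hmem n)
    obtain ⟨φ, hφ, hφA⟩ := Filter.extraction_forall_of_frequently fun n =>
      Nat.frequently_atTop_iff_infinite.2 (hinf n)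
    have hsub : trace (range φ) ⊆ ⋂ n, C n := subset_iInter fun n => by
      rw [← hA, trace_subset_iff]
      refine ((finite_Iio n).image φ).subset ?_
      rintro _ ⟨⟨k, rfl⟩, hk⟩
      exact ⟨k, mem_Iio.2 (not_le.1 fun hnk => hk (mem_iInter₂.1 (hφA k) n hnk)), rfl⟩
    refine Nonempty.mono (interior_maximal hsub (isClopen_trace _).isOpen) ?_
    rw [nonempty_iff_ne_empty, Ne, trace_eq_empty_iff]
    exact infinite_range_of_injective hφ.injective
  not_isOpen_singleton x hx := by
    obtain ⟨A, hA⟩ := exists_trace_eq ⟨isClosed_singleton, hx⟩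
    have hAinf : A.Infinite := fun h => singleton_ne_empty x (hA ▸ trace_eq_empty_iff.2 h)
    obtain ⟨S, T, hST, hdisj, hcard⟩ := hAinf.exists_union_disjoint_cardinal_eq_of_infinite
    have hfin : S.Finite ↔ T.Finite := by
      rw [← Cardinal.lt_aleph0_iff_set_finite, hcard, Cardinal.lt_aleph0_iff_set_finite]
    have hmem : ∀ S ⊆ A, S.Infinite → x ∈ trace S := fun S hSA hS => by
      obtain ⟨y, hy⟩ := nonempty_iff_ne_empty.2 (mt trace_eq_empty_iff.1 hS)
      have : y ∈ ({x} : Set _) := hA ▸ trace_subset_iff.2 (by simp [sdiff_eq_empty.2 hSA]) hy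
      exact mem_singleton_iff.1 this ▸ hy
    have hS : S.Infinite := fun hS => hAinf (hST ▸ hS.union (hfin.1 hS))
    have hT : T.Infinite := fun hT => hS (hfin.2 hT)
    exact disjoint_left.1 (disjoint_trace_iff.2 (by simp [hdisj.inter_eq]))
      (hmem S (hST ▸ subset_union_left) hS) (hmem T (hST ▸ subset_union_right) hT)

theorem mk_clopens_le : Cardinal.mk {c : Set omegaStar // IsClopen c} ≤ Cardinal.continuum := by
  have hsurj : Surjective fun A : Set ℕ =>
      (⟨trace A, isClopen_trace A⟩ : {c : Set omegaStar // IsClopen c}) := fun c =>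
    (exists_trace_eq c.2).imp fun A hA => Subtype.ext hA
  simpa using Cardinal.mk_le_of_surjective hsurj

end omegaStar

end Remainder

theorem stmt6 (ch : Cardinal.continuum.{0} = Cardinal.aleph 1)
    (K L : Set ↥omegaStar)
    (hKc : IsClosed K) (hKn : IsNowhereDense K) (hKp : IsPSet K)
    (hLc : IsClosed L) (hLn : IsNowhereDense L) (hLp : IsPSet L)
    (h : ↥K ≃ₜ ↥L) :
    ∃ H : ↥omegaStar ≃ₜ ↥omegaStar, ∀ x : ↥K, H ↑x = ↑(h x) :=
  omegaStar.isParovicenko.exists_homeomorph_extending (omegaStar.mk_clopens_le.trans_eq ch)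
    hKc hKn hKp hLc hLn hLp h
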